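/- arXiv:1708.05108 — 7 statements merged into one kernel-verified Lean document; each statement's English description precedes it below -/
import Mathlib

section
/- Every invariant Lagrangian subspace L of V = 𝔤 ⊕ 𝔤* is the internal direct sum L = L_𝔷 ⊕ L₁ ⊕ … ⊕ Lₙ, where L_𝔷 := L ∩ (𝔷 ⊕ 𝔷*) is a Lagrangian subspace of 𝔷 ⊕ 𝔷* (for the restriction of ω) and, for each i, Lᵢ := L ∩ (𝔤ᵢ ⊕ 𝔤ᵢ*) is a Lagrangian subspace of 𝔤ᵢ ⊕ 𝔤ᵢ* (for the restriction of ω) that is stable under the adjoint–coadjoint action of 𝔤. -/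
namespace QPar

variable (k g : Type*) [Field k] [LieRing g] [LieAlgebra k g]

/-- The canonical symplectic form ω on V = 𝔤 ⊕ 𝔤*:
`ω((ξ,φ),(ξ',φ')) = φ(ξ') − φ'(ξ)`. -/
def omegaV (u v : g × Module.Dual k g) : k := u.2 v.1 - v.2 u.1

/-- The adjoint–coadjoint action of 𝔤 on V = 𝔤 ⊕ 𝔤*:
`η·(ξ,φ) = (⁅η,ξ⁆, −φ∘ad(η))`. -/
def adCoad (η : g) (v : g × Module.Dual k g) : g × Module.Dual k g :=
  (⁅η, v.1⁆, - (v.2 ∘ₗ (LieAlgebra.ad k g η : g →ₗ[k] g)))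

/-- A subspace of V is invariant if it is stable under the adjoint–coadjoint action. -/
def IsInvariant (L : Submodule k (g × Module.Dual k g)) : Prop :=
  ∀ η : g, ∀ v ∈ L, adCoad k g η v ∈ L

/-- A subspace of V is Lagrangian if it equals its ω-orthogonal complement. -/
def IsLagrangian (L : Submodule k (g × Module.Dual k g)) : Prop :=
  ∀ v : g × Module.Dual k g, v ∈ L ↔ ∀ w ∈ L, omegaV k g v w = 0

/-- `L` is a Lagrangian subspace of the subspace `W` of V, for the restriction of ω:
`L ⊆ W` and `L` equals its ω-orthogonal complement taken inside `W`. -/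
def IsLagrangianIn (W L : Submodule k (g × Module.Dual k g)) : Prop :=
  L ≤ W ∧ ∀ v ∈ W, (v ∈ L ↔ ∀ w ∈ L, omegaV k g v w = 0)

/-- The center of 𝔤, as a subspace. -/
def centerS : Submodule k g := (LieAlgebra.center k g).toSubmodule

/-- `I` is a simple ideal of 𝔤: an ideal which is nonabelian and has no
nontrivial proper ideals. -/
def IsSimpleIdeal (I : Submodule k g) : Prop :=
  (∀ η : g, ∀ x ∈ I, ⁅η, x⁆ ∈ I) ∧
  (∃ x ∈ I, ∃ y ∈ I, ⁅x, y⁆ ≠ 0) ∧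
  ∀ J : Submodule k g, J ≤ I → (∀ x ∈ I, ∀ y ∈ J, ⁅x, y⁆ ∈ J) → J = ⊥ ∨ J = I

/-- 𝔷*, realized as the subspace of 𝔤* of functionals vanishing on all the 𝔤ᵢ. -/
def zDual {n : ℕ} (gi : Fin n → Submodule k g) : Submodule k (Module.Dual k g) :=
  (⨆ i, gi i).dualAnnihilator

/-- 𝔤ᵢ*, realized as the subspace of 𝔤* of functionals vanishing on all the other
summands, i.e. on 𝔷 and on the 𝔤ⱼ for j ≠ i. -/
def giDual {n : ℕ} (gi : Fin n → Submodule k g) (i : Fin n) :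
    Submodule k (Module.Dual k g) :=
  (centerS k g ⊔ ⨆ j, ⨆ _ : j ≠ i, gi j).dualAnnihilator

/-- The subspace 𝔷 ⊕ 𝔷* of V. -/
def zPart {n : ℕ} (gi : Fin n → Submodule k g) : Submodule k (g × Module.Dual k g) :=
  (centerS k g).prod (zDual k g gi)

/-- The subspace 𝔤ᵢ ⊕ 𝔤ᵢ* of V. -/
def giPart {n : ℕ} (gi : Fin n → Submodule k g) (i : Fin n) :
    Submodule k (g × Module.Dual k g) :=
  (gi i).prod (giDual k g gi i)

end QPar

namespace QPar

section Decomposition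

variable {k g ι : Type*} [Field k] [LieRing g] [LieAlgebra k g]

/-- The subspace `𝔪 ⊕ 𝔪*` of `V` attached to a summand `𝔪 = A o` of a family of subspaces `A`,
where `𝔪*` consists of the functionals vanishing on all the other summands. -/
def summandPart (A : ι → Submodule k g) (o : ι) : Submodule k (g × Module.Dual k g) :=
  (A o).prod (⨆ o', ⨆ _ : o' ≠ o, A o').dualAnnihilator

lemma mem_summandPart {A : ι → Submodule k g} {o : ι} {v : g × Module.Dual k g} :
    v ∈ summandPart A o ↔ v.1 ∈ A o ∧ ∀ o', o' ≠ o → ∀ x ∈ A o', v.2 x = 0 := by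
  simp only [summandPart, Submodule.mem_prod, Submodule.dualAnnihilator_iSup_eq,
    Submodule.mem_iInf, Submodule.mem_dualAnnihilator]

lemma omegaV_add_right (v w w' : g × Module.Dual k g) :
    omegaV k g v (w + w') = omegaV k g v w + omegaV k g v w' := by
  simp only [omegaV, Prod.fst_add, Prod.snd_add, map_add, LinearMap.add_apply]
  ring

/-- The linear functional `ω(v, ·)`. -/
def omegaRight (v : g × Module.Dual k g) : (g × Module.Dual k g) →ₗ[k] k where
  toFun := omegaV k g v
  map_add' := omegaV_add_right v
  map_smul' c w := by
    simp only [omegaV, Prod.smul_fst, Prod.smul_snd, map_smul, LinearMap.smul_apply,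
      smul_eq_mul, RingHom.id_apply]
    ring

lemma eq_zero_of_omegaV_eq_zero {v : g × Module.Dual k g} (h : ∀ w, omegaV k g v w = 0) :
    v = 0 := by
  refine Prod.ext ((Module.forall_dual_apply_eq_zero_iff k v.1).1 fun f => ?_)
    (LinearMap.ext fun x => ?_)
  · simpa [omegaV] using h (0, f)
  · simpa [omegaV] using h (x, 0)

lemma omegaV_eq_zero_of_ne {A : ι → Submodule k g} {o o' : ι} (h : o ≠ o')
    {v w : g × Module.Dual k g} (hv : v ∈ summandPart A o) (hw : w ∈ summandPart A o') :
    omegaV k g v w = 0 := by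
  rw [mem_summandPart] at hv hw
  rw [omegaV, hv.2 o' h.symm _ hw.1, hw.2 o h _ hv.1, sub_zero]

/-- Every vector of `V` is the sum of its components along a decomposition of `𝔤`. -/
lemma exists_sum_summandPart [Fintype ι] [DecidableEq ι] {A : ι → Submodule k g}
    (hA : DirectSum.IsInternal A) (v : g × Module.Dual k g) :
    ∃ f : ι → g × Module.Dual k g, (∀ o, f o ∈ summandPart A o) ∧ ∑ o, f o = v := by
  classical
  let e := LinearEquiv.ofBijective (DirectSum.coeLinearMap A) hA
  let π : ι → g →ₗ[k] g := fun o =>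
    (A o).subtype ∘ₗ DirectSum.component k ι (fun i => A i) o ∘ₗ e.symm.toLinearMap
  have hsum (x : g) : ∑ o, π o x = x := by
    have h := e.apply_symm_apply x
    conv_rhs => rw [← h]
    change _ = DirectSum.coeLinearMap A (e.symm x)
    rw [DirectSum.coeLinearMap_eq_dfinsuppSum,
      DFinsupp.sum_eq_sum_fintype _ (fun _ => rfl)]
    rfl
  have hzero {o o' : ι} (h : o' ≠ o) (x : g) (hx : x ∈ A o') : π o x = 0 := by
    have h' : e.symm x = DirectSum.lof k ι (fun i => A i) o' ⟨x, hx⟩ := by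
      rw [LinearEquiv.symm_apply_eq]
      exact (DirectSum.coeLinearMap_lof A o' ⟨x, hx⟩).symm
    simp only [π, LinearMap.comp_apply, LinearEquiv.coe_coe, h', Submodule.subtype_apply]
    rw [DirectSum.component.of, dif_neg h, Submodule.coe_zero]
  refine ⟨fun o => (π o v.1, v.2 ∘ₗ π o), fun o => ?_, ?_⟩
  · rw [mem_summandPart]
    exact ⟨Submodule.coe_mem _, fun o' h x hx => by simp [hzero h x hx]⟩
  · refine Prod.ext ?_ (LinearMap.ext fun x => ?_)
    · simp [Prod.fst_sum, hsum]
    · simp [Prod.snd_sum, LinearMap.sum_apply, ← map_sum, hsum]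

lemma disjoint_summandPart [Fintype ι] [DecidableEq ι] {A : ι → Submodule k g}
    (hA : DirectSum.IsInternal A) (o : ι) :
    Disjoint (summandPart A o) (⨆ o', ⨆ _ : o' ≠ o, summandPart A o') := by
  rw [Submodule.disjoint_def]
  intro v hv hv'
  refine eq_zero_of_omegaV_eq_zero fun w => ?_
  obtain ⟨f, hf, rfl⟩ := exists_sum_summandPart hA w
  change omegaRight v _ = 0
  rw [map_sum]
  refine Finset.sum_eq_zero fun o' _ => ?_
  by_cases h : o' = o
  · subst h
    have hle : (⨆ o, ⨆ _ : o ≠ o', summandPart A o) ≤ LinearMap.ker (omegaRight (f o')) :=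
      iSup₂_le fun o h u hu => omegaV_eq_zero_of_ne h.symm (hf o') hu
    have hfv : (f o').2 v.1 - v.2 (f o').1 = 0 := hle hv'
    change v.2 (f o').1 - (f o').2 v.1 = 0
    rw [← neg_sub, hfv, neg_zero]
  · exact omegaV_eq_zero_of_ne (Ne.symm h) hv (hf o')

/-- If a Lagrangian subspace contains the components of each of its vectors, its intersection with
each `summandPart` is Lagrangian there. -/
lemma isLagrangianIn_summandPart [Fintype ι] [DecidableEq ι] {A : ι → Submodule k g}
    {L : Submodule k (g × Module.Dual k g)} (hL : IsLagrangian k g L)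
    (hsplit : ∀ v ∈ L, ∃ f : ι → g × Module.Dual k g,
      (∀ o, f o ∈ L ⊓ summandPart A o) ∧ ∑ o, f o = v) (o : ι) :
    IsLagrangianIn k g (summandPart A o) (L ⊓ summandPart A o) := by
  refine ⟨inf_le_right, fun v hv => ⟨fun h w hw => (hL v).1 h.1 w hw.1, fun h => ⟨?_, hv⟩⟩⟩
  refine (hL v).2 fun w hw => ?_
  obtain ⟨f, hf, rfl⟩ := hsplit w hw
  change omegaRight v _ = 0
  rw [map_sum]
  refine Finset.sum_eq_zero fun o' _ => ?_
  by_cases ho : o' = o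
  · subst ho
    exact h _ (hf o')
  · exact omegaV_eq_zero_of_ne (Ne.symm ho) hv (hf o').2

lemma adCoad_apply_snd (η : g) (v : g × Module.Dual k g) (x : g) :
    (adCoad k g η v).2 x = -v.2 ⁅η, x⁆ := rfl

lemma adCoad_add (η : g) (v w : g × Module.Dual k g) :
    adCoad k g η (v + w) = adCoad k g η v + adCoad k g η w := by
  refine Prod.ext (lie_add η v.1 w.1) (LinearMap.ext fun x => ?_)
  change -(v.2 + w.2) ⁅η, x⁆ = -v.2 ⁅η, x⁆ + -w.2 ⁅η, x⁆
  rw [LinearMap.add_apply, neg_add]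

lemma adCoad_sum {s : Finset ι} (η : g) (f : ι → g × Module.Dual k g) :
    adCoad k g η (∑ o ∈ s, f o) = ∑ o ∈ s, adCoad k g η (f o) :=
  map_sum (AddMonoidHom.mk' (adCoad k g η) (adCoad_add η)) f s

lemma adCoad_mem_summandPart {A : ι → Submodule k g}
    (hideal : ∀ o, ∀ η : g, ∀ x ∈ A o, ⁅η, x⁆ ∈ A o) {o : ι} (η : g)
    {v : g × Module.Dual k g} (hv : v ∈ summandPart A o) :
    adCoad k g η v ∈ summandPart A o := by
  rw [mem_summandPart] at hv ⊢
  exact ⟨hideal o η _ hv.1, fun o' h x hx => by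
    rw [adCoad_apply_snd, hv.2 o' h _ (hideal o' η x hx), neg_zero]⟩

lemma adCoad_eq_zero_of_ne {A : ι → Submodule k g} (hA : iSupIndep A)
    (hideal : ∀ o, ∀ η : g, ∀ x ∈ A o, ⁅η, x⁆ ∈ A o) {o o' : ι} (h : o ≠ o') {η : g}
    (hη : η ∈ A o) {v : g × Module.Dual k g} (hv : v ∈ summandPart A o') :
    adCoad k g η v = 0 := by
  have hmem (x : g) : ⁅η, x⁆ ∈ A o := by
    rw [← lie_skew]
    exact neg_mem (hideal o x η hη)
  rw [mem_summandPart] at hv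
  refine Prod.ext ?_ (LinearMap.ext fun x => ?_)
  · exact Submodule.disjoint_def.1 (hA.pairwiseDisjoint h) _ (hmem _) (hideal o' η _ hv.1)
  · rw [adCoad_apply_snd, hv.2 o h _ (hmem x)]
    simp

/-- If `I` is a simple ideal then no quotient of `I ⊕ I*` by a submodule has nonzero invariants. -/
lemma mem_of_adCoad_mem [FiniteDimensional k g] {I C : Submodule k g}
    (hI : IsSimpleIdeal k g I) (hIC : I ⊔ C = ⊤)
    {N : Submodule k (g × Module.Dual k g)} (hN : N ≤ I.prod C.dualAnnihilator)
    (hinv : IsInvariant k g N) {v : g × Module.Dual k g}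
    (hv : v ∈ I.prod C.dualAnnihilator) (h : ∀ η ∈ I, adCoad k g η v ∈ N) : v ∈ N := by
  obtain ⟨hideal, ⟨a, ha, b, hb, hab⟩, hsimp⟩ := hI
  have hext {φ : Module.Dual k g} (hφ : φ ∈ C.dualAnnihilator) (hφI : ∀ x ∈ I, φ x = 0) :
      φ = 0 := by
    have : I ⊔ C ≤ LinearMap.ker φ :=
      sup_le hφI ((Submodule.mem_dualAnnihilator φ).1 hφ)
    exact LinearMap.ker_eq_top.1 (top_le_iff.1 (hIC ▸ this))
  obtain ⟨ξ₀, hξ₀⟩ : ∃ ξ₀, (ξ₀, v.2) ∈ N := by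
    let N₂ : Submodule k (Module.Dual k g) := N.map (LinearMap.snd k g (Module.Dual k g))
    have hmap {u : g × Module.Dual k g} (hu : u ∈ N) : u.2 ∈ N₂ := ⟨u, hu, rfl⟩
    have hN₂ : N₂ ≤ C.dualAnnihilator := by
      rintro _ ⟨u, hu, rfl⟩
      exact (hN hu).2
    suffices v.2 ∈ N₂ by
      obtain ⟨⟨ξ, φ⟩, hu, hφ⟩ := this
      exact ⟨ξ, by rwa [← hφ]⟩
    rcases hsimp (I ⊓ N₂.dualCoannihilator) inf_le_left (fun x hx y hy => by
        refine ⟨hideal x y hy.1, (Submodule.mem_dualCoannihilator _).2 ?_⟩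
        rintro _ ⟨u, hu, rfl⟩
        have := (Submodule.mem_dualCoannihilator _).1 hy.2 _ (hmap (hinv x u hu))
        simpa [adCoad_apply_snd] using this) with hJ | hJ
    · rw [← Subspace.dualCoannihilator_dualAnnihilator_eq (W := N₂),
        Submodule.mem_dualAnnihilator]
      intro x hx
      obtain ⟨y, hy, z, hz, rfl⟩ := Submodule.mem_sup.1 (hIC ▸ Submodule.mem_top : x ∈ I ⊔ C)
      have hz' : z ∈ N₂.dualCoannihilator := (Submodule.mem_dualCoannihilator _).2
        fun φ hφ => (Submodule.mem_dualAnnihilator φ).1 (hN₂ hφ) z hz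
      have hy' : y ∈ I ⊓ N₂.dualCoannihilator := ⟨hy, by simpa using sub_mem hx hz'⟩
      rw [hJ, Submodule.mem_bot] at hy'
      rw [hy', zero_add]
      exact (Submodule.mem_dualAnnihilator _).1 hv.2 z hz
    · have hzero {φ : Module.Dual k g} (hφ : φ ∈ N₂) (x : g) (hx : x ∈ I) : φ x = 0 :=
        (Submodule.mem_dualCoannihilator _).1 (hJ.ge hx).2 φ hφ
      have hker (η : g) (hη : η ∈ I) (x : g) (hx : x ∈ I) : v.2 ⁅η, x⁆ = 0 := by
        simpa [adCoad_apply_snd] using hzero (hmap (h η hη)) x hx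
      have hv0 : v.2 = 0 := by
        refine hext hv.2 fun x hx => ?_
        rcases hsimp (I ⊓ LinearMap.ker v.2) inf_le_left
          (fun x hx y hy => ⟨hideal x y hy.1, hker x hx y hy.1⟩) with hK | hK
        · exact absurd ((Submodule.mem_bot k).1
            (hK ▸ ⟨hideal a b hb, hker a ha b hb⟩ : ⁅a, b⁆ ∈ (⊥ : Submodule k g))) hab
        · exact (hK.ge hx).2
      rw [hv0]
      exact zero_mem _
  have hsub : v = (v.1 - ξ₀, 0) + (ξ₀, v.2) := by simp
  have hmem : v.1 - ξ₀ ∈ I := sub_mem hv.1 (hN hξ₀).1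
  have hbr (η : g) (hη : η ∈ I) : ((⁅η, v.1 - ξ₀⁆, 0) : g × Module.Dual k g) ∈ N := by
    convert sub_mem (h η hη) (hinv η _ hξ₀) using 1
    simp [adCoad]
  rw [hsub]
  refine add_mem ?_ hξ₀
  rcases hsimp (I ⊓ N.comap (LinearMap.inl k g (Module.Dual k g))) inf_le_left
    (fun x hx y hy => ⟨hideal x y hy.1, by
      have := hinv x _ hy.2
      simpa [adCoad] using this⟩) with hJ | hJ
  · have hzero (η : g) (hη : η ∈ I) : ⁅η, v.1 - ξ₀⁆ = 0 :=
      (Submodule.mem_bot k).1 (hJ.le ⟨hideal η _ hmem, hbr η hη⟩)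
    let Z : Submodule k g :=
      { carrier := {x | ∀ η ∈ I, ⁅η, x⁆ = 0}
        zero_mem' := fun η _ => lie_zero η
        add_mem' := fun hx hy η hη => by rw [lie_add, hx η hη, hy η hη, add_zero]
        smul_mem' := fun c x hx η hη => by rw [lie_smul, hx η hη, smul_zero] }
    rcases hsimp (I ⊓ Z) inf_le_left
      (fun x hx y hy => by rw [hy.2 x hx]; exact zero_mem _) with hZ | hZ
    · have : v.1 - ξ₀ = 0 := (Submodule.mem_bot k).1 (hZ.le ⟨hmem, hzero⟩)
      rw [this]
      exact zero_mem _
    · exact absurd ((hZ.ge hb).2 a ha) hab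
  · exact (hJ.ge hmem).2

/-- An invariant subspace contains the component of each of its vectors along a simple summand. -/
lemma component_mem [FiniteDimensional k g] [Fintype ι] [DecidableEq ι] {A : ι → Submodule k g}
    (hA : DirectSum.IsInternal A) (hideal : ∀ o, ∀ η : g, ∀ x ∈ A o, ⁅η, x⁆ ∈ A o)
    {L : Submodule k (g × Module.Dual k g)} (hinv : IsInvariant k g L)
    {f : ι → g × Module.Dual k g} (hf : ∀ o, f o ∈ summandPart A o) (hL : ∑ o, f o ∈ L)
    {o : ι} (ho : IsSimpleIdeal k g (A o)) : f o ∈ L := by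
  have hcompl : A o ⊔ ⨆ o', ⨆ _ : o' ≠ o, A o' = ⊤ := by
    refine top_le_iff.1 (hA.submodule_iSup_eq_top ▸ iSup_le fun o' => ?_)
    by_cases h : o' = o
    · exact h ▸ le_sup_left
    · exact le_sup_of_le_right (le_iSup₂_of_le o' h le_rfl)
  refine (mem_of_adCoad_mem (N := L ⊓ summandPart A o) ho hcompl inf_le_right
    (fun η v hv => ⟨hinv η v hv.1, adCoad_mem_summandPart hideal η hv.2⟩) (hf o)
    fun η hη => ⟨?_, adCoad_mem_summandPart hideal η (hf o)⟩).1
  have := hinv η _ hL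
  rwa [adCoad_sum, Finset.sum_eq_single o (fun o' _ h =>
    adCoad_eq_zero_of_ne hA.submodule_iSupIndep hideal h.symm hη (hf o')) (by simp)] at this

end Decomposition

lemma zPart_eq_summandPart {k g : Type*} [Field k] [LieRing g] [LieAlgebra k g] {n : ℕ}
    (gi : Fin n → Submodule k g) :
    zPart k g gi = summandPart (fun o : Option (Fin n) => o.elim (centerS k g) gi) none := by
  simp [zPart, zDual, summandPart, iSup_option]

lemma giPart_eq_summandPart {k g : Type*} [Field k] [LieRing g] [LieAlgebra k g] {n : ℕ}
    (gi : Fin n → Submodule k g) (i : Fin n) :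
    giPart k g gi i =
      summandPart (fun o : Option (Fin n) => o.elim (centerS k g) gi) (some i) := by
  simp [giPart, giDual, summandPart, iSup_option]

end QPar

/-- Every invariant Lagrangian subspace `L` of `V = 𝔤 ⊕ 𝔤*` is the
internal direct sum `L = L_𝔷 ⊕ L₁ ⊕ … ⊕ Lₙ`, where `L_𝔷 := L ∩ (𝔷 ⊕ 𝔷*)` is Lagrangian
in `𝔷 ⊕ 𝔷*` and each `Lᵢ := L ∩ (𝔤ᵢ ⊕ 𝔤ᵢ*)` is a Lagrangian subspace of `𝔤ᵢ ⊕ 𝔤ᵢ*`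
stable under the adjoint–coadjoint action of 𝔤. -/
theorem statement0
    (k g : Type*) [Field k] [CharZero k] [IsAlgClosed k]
    [LieRing g] [LieAlgebra k g] [FiniteDimensional k g]
    (n : ℕ) (gi : Fin n → Submodule k g)
    (hsimple : ∀ i, QPar.IsSimpleIdeal k g (gi i))
    (hdec : DirectSum.IsInternal (fun o : Option (Fin n) => o.elim (QPar.centerS k g) gi))
    (L : Submodule k (g × Module.Dual k g))
    (hinv : QPar.IsInvariant k g L) (hlag : QPar.IsLagrangian k g L) :
    QPar.IsLagrangianIn k g (QPar.zPart k g gi) (L ⊓ QPar.zPart k g gi) ∧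
    (∀ i, QPar.IsLagrangianIn k g (QPar.giPart k g gi i) (L ⊓ QPar.giPart k g gi i) ∧
        QPar.IsInvariant k g (L ⊓ QPar.giPart k g gi i)) ∧
    L = (L ⊓ QPar.zPart k g gi) ⊔ (⨆ i, L ⊓ QPar.giPart k g gi i) ∧
    (∀ o : Option (Fin n),
      Disjoint (o.elim (L ⊓ QPar.zPart k g gi) (fun i => L ⊓ QPar.giPart k g gi i))
        (⨆ o' : Option (Fin n), ⨆ _ : o' ≠ o,
          o'.elim (L ⊓ QPar.zPart k g gi) (fun i => L ⊓ QPar.giPart k g gi i))) := by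
  have hideal : ∀ o : Option (Fin n), ∀ η : g,
      ∀ x ∈ o.elim (QPar.centerS k g) gi, ⁅η, x⁆ ∈ o.elim (QPar.centerS k g) gi := by
    rintro (_ | i) η x hx
    · exact (LieAlgebra.center k g).lie_mem hx
    · exact (hsimple i).1 η x hx
  have hsplit : ∀ v ∈ L, ∃ f : Option (Fin n) → g × Module.Dual k g,
      (∀ o, f o ∈ L ⊓ QPar.summandPart (fun o => o.elim (QPar.centerS k g) gi) o) ∧
        ∑ o, f o = v := by
    intro v hv
    obtain ⟨f, hf, rfl⟩ := QPar.exists_sum_summandPart hdec v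
    have hsome (i : Fin n) : f (some i) ∈ L :=
      QPar.component_mem hdec hideal hinv hf hv (hsimple i)
    refine ⟨f, ?_, rfl⟩
    rintro (_ | i)
    · refine ⟨?_, hf none⟩
      rw [Fintype.sum_option] at hv
      exact (Submodule.add_mem_iff_left L (sum_mem fun i _ => hsome i)).1 hv
    · exact ⟨hsome i, hf (some i)⟩
  simp only [QPar.zPart_eq_summandPart, QPar.giPart_eq_summandPart]
  refine ⟨QPar.isLagrangianIn_summandPart hlag hsplit none, fun i =>
    ⟨QPar.isLagrangianIn_summandPart hlag hsplit (some i), fun η v hv =>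
      ⟨hinv η v hv.1, QPar.adCoad_mem_summandPart hideal η hv.2⟩⟩,
    le_antisymm (fun v hv => ?_) (sup_le inf_le_left (iSup_le fun i => inf_le_left)), fun o => ?_⟩
  · obtain ⟨f, hf, rfl⟩ := hsplit v hv
    rw [Fintype.sum_option]
    exact add_mem (Submodule.mem_sup_left (hf none)) (Submodule.mem_sup_right
      (sum_mem fun i _ => Submodule.mem_iSup_of_mem i (hf (some i))))
  · have hle (o : Option (Fin n)) :
        o.elim (L ⊓ QPar.summandPart (fun o => o.elim (QPar.centerS k g) gi) none)
          (fun i => L ⊓ QPar.summandPart (fun o => o.elim (QPar.centerS k g) gi) (some i)) ≤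
        QPar.summandPart (fun o => o.elim (QPar.centerS k g) gi) o := by
      cases o <;> exact inf_le_right
    exact (QPar.disjoint_summandPart hdec o).mono (hle o)
      (iSup₂_mono fun o' _ => hle o')
end

section
/- For every invariant Lagrangian subspace L of V = 𝔤 ⊕ 𝔤*, there exists a linear isomorphism L ≅ 𝔤 commuting with the 𝔤-actions, where 𝔤 acts on L by the adjoint–coadjoint action and on itself by the adjoint action; i.e. L and 𝔤 are (non-canonically) isomorphic as 𝔤-modules. -/
namespace QPar

section Ideals

variable {k g : Type*} [Field k] [LieRing g] [LieAlgebra k g]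

lemma mem_center_of_forall_lie_eq_zero {s : LieIdeal k g}
    (hsup : LieAlgebra.center k g ⊔ s = ⊤) {x : g} (hx : ∀ y ∈ s, ⁅y, x⁆ = 0) :
    x ∈ LieAlgebra.center k g := by
  rw [LieModule.mem_maxTrivSubmodule]
  intro y
  obtain ⟨c, hc, t, ht, rfl⟩ :=
    (LieSubmodule.mem_sup _ _ y).mp (hsup ▸ LieSubmodule.mem_top y)
  rw [add_lie, hx t ht, add_zero, ← lie_skew, hc x, neg_zero]

/-- If `g` is the direct sum of its center and an ideal `s` that is a sum of simple ideals,
then `s` contains no nonzero abelian ideal. -/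
lemma eq_bot_of_isLieAbelian_of_le {ι : Type*} {G : ι → LieIdeal k g}
    (hG : ∀ i, IsSimpleIdeal k g (G i).toSubmodule)
    (hcompl : IsCompl (LieAlgebra.center k g) (⨆ i, G i))
    (A : LieIdeal k g) [IsLieAbelian A] (hA : A ≤ ⨆ i, G i) : A = ⊥ := by
  have habel : ∀ x ∈ A, ∀ y ∈ A, ⁅x, y⁆ = 0 := fun x hx y hy ↦
    congrArg Subtype.val (trivial_lie_zero A A ⟨x, hx⟩ ⟨y, hy⟩)
  have hbot (i : ι) : A ⊓ G i = ⊥ := by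
    obtain ⟨-, ⟨x, hx, y, hy, hxy⟩, hmin⟩ := hG i
    rcases hmin (A ⊓ G i).toSubmodule (fun z hz ↦ hz.2)
      (fun a _ b hb ↦ (A ⊓ G i).lie_mem hb) with h | h
    · exact (LieSubmodule.toSubmodule_eq_bot _).mp h
    · have hle : ∀ z ∈ (G i).toSubmodule, z ∈ A := fun z hz ↦ by
        rw [← h] at hz
        exact hz.1
      exact absurd (habel x (hle x hx) y (hle y hy)) hxy
  have hcenter : A ≤ LieAlgebra.center k g := fun x hx ↦ by
    refine mem_center_of_forall_lie_eq_zero hcompl.sup_eq_top fun y hy ↦ ?_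
    refine LieSubmodule.iSup_induction G (motive := fun y ↦ ⁅y, x⁆ = 0) hy (fun i y hy ↦ ?_)
      (zero_lie x) fun y z hy hz ↦ by rw [add_lie, hy, hz, add_zero]
    have : ⁅y, x⁆ ∈ A ⊓ G i := ⟨A.lie_mem hx, lie_mem_left k g _ y x hy⟩
    rwa [hbot i, LieSubmodule.mem_bot] at this
  exact le_bot_iff.mp (hcompl.disjoint hcenter hA)

/-- If an ideal `s` contains no nonzero abelian ideal of `g`, then the Killing form of `g` is
nondegenerate on every ideal contained in `s`. -/
lemma disjoint_killingCompl_of_le [CharZero k] [FiniteDimensional k g] {s : LieIdeal k g}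
    (hs : ∀ A : LieIdeal k g, IsLieAbelian A → A ≤ s → A = ⊥) (I : LieIdeal k g) (hI : I ≤ s) :
    Disjoint I (I.killingCompl k g) := by
  rw [disjoint_iff]
  have hsolv : LieAlgebra.IsSolvable ↥(I ⊓ I.killingCompl k g) := by
    refine LieIdeal.isSolvable_of_killingForm_apply_lie_eq_zero _ fun x hx y hy ↦ ?_
    exact (LieIdeal.mem_killingCompl k g I).mp (LieSubmodule.lie_le_right _ _ hy).2 x hx.1
  rw [← LieAlgebra.abelian_of_solvable_ideal_eq_bot_iff]
  refine hs _ (LieAlgebra.abelian_derivedAbelianOfIdeal _)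
    (le_trans (b := I ⊓ I.killingCompl k g) ?_ (inf_le_left.trans hI))
  unfold LieAlgebra.derivedAbelianOfIdeal
  split
  · exact bot_le
  · exact LieAlgebra.derivedSeriesOfIdeal_le_self _ _

lemma isCompl_killingCompl_of_le [CharZero k] [FiniteDimensional k g] {s : LieIdeal k g}
    (hs : ∀ A : LieIdeal k g, IsLieAbelian A → A ≤ s → A = ⊥) (I : LieIdeal k g) (hI : I ≤ s) :
    IsCompl I (I.killingCompl k g) := by
  rw [← LieSubmodule.isCompl_toSubmodule, LieIdeal.toSubmodule_killingCompl,
    LinearMap.BilinForm.isCompl_orthogonal_iff_disjoint (LieModule.traceForm_isSymm k g g).isRefl,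
    ← LieIdeal.toSubmodule_killingCompl, LieSubmodule.disjoint_toSubmodule]
  exact disjoint_killingCompl_of_le hs I hI

/-- Functionals on `g` map equivariantly to any ideal on which the Killing form is nondegenerate,
with kernel the functionals vanishing on that ideal. -/
lemma exists_equivariant_of_disjoint_killingCompl [FiniteDimensional k g] (J : LieIdeal k g)
    (hJ : Disjoint J (J.killingCompl k g)) :
    ∃ S : Module.Dual k g →ₗ[k] g, (∀ φ, S φ ∈ J) ∧ (∀ φ, S φ = 0 → ∀ x ∈ J, φ x = 0) ∧
      ∀ (η : g) (φ : Module.Dual k g),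
        S (-(φ ∘ₗ (LieAlgebra.ad k g η : g →ₗ[k] g))) = ⁅η, S φ⁆ := by
  let κ : J.toSubmodule →ₗ[k] Module.Dual k J.toSubmodule :=
    (killingForm k g).restrict J.toSubmodule
  have hκ (x y : J.toSubmodule) : κ x y = killingForm k g x y := rfl
  have hinj : Function.Injective κ := by
    rw [injective_iff_map_eq_zero]
    rintro ⟨x, hx⟩ h
    have hx' : x ∈ J.killingCompl k g := (LieIdeal.mem_killingCompl k g J).mpr fun y hy ↦ by
      rw [LieModule.traceForm_comm]
      exact LinearMap.congr_fun h ⟨y, hy⟩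
    have := hJ.le_bot ⟨hx, hx'⟩
    exact Subtype.ext this
  let e := LinearEquiv.ofInjectiveOfFinrankEq κ hinj Subspace.dual_finrank_eq.symm
  have he (φ : Module.Dual k J.toSubmodule) : κ (e.symm φ) = φ := e.apply_symm_apply φ
  let r : Module.Dual k g →ₗ[k] Module.Dual k J.toSubmodule := J.toSubmodule.subtype.dualMap
  have hr (φ : Module.Dual k g) (y : J.toSubmodule) :
      killingForm k g (e.symm (r φ) : J.toSubmodule) y = φ y := by
    rw [← hκ, he]
    rfl
  refine ⟨J.toSubmodule.subtype ∘ₗ e.symm.toLinearMap ∘ₗ r, fun φ ↦ (e.symm (r φ)).2,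
    fun φ h x hx ↦ ?_, fun η φ ↦ ?_⟩
  · have h0 : ((e.symm (r φ) : J.toSubmodule) : g) = 0 := h
    rw [← hr φ ⟨x, hx⟩, h0, map_zero, LinearMap.zero_apply]
  · let j : J.toSubmodule := ⟨⁅η, (e.symm (r φ) : J.toSubmodule)⁆, J.lie_mem (e.symm (r φ)).2⟩
    change ((e.symm (r _) : J.toSubmodule) : g) = (j : g)
    refine congrArg Subtype.val (hinj (LinearMap.ext fun y ↦ ?_))
    rw [hκ, hκ, hr, LieModule.traceForm_apply_lie_apply']
    exact congrArg Neg.neg (hr φ ⟨⁅η, (y : g)⁆, J.lie_mem y.2⟩).symm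

/-- Functionals on `g` map equivariantly to any central subspace, with kernel the functionals
vanishing on that subspace. -/
lemma exists_equivariant_of_le_center [FiniteDimensional k g] (Z : Submodule k g)
    (hZ : Z ≤ (LieAlgebra.center k g).toSubmodule) :
    ∃ S : Module.Dual k g →ₗ[k] g, (∀ φ, S φ ∈ Z) ∧ (∀ φ, S φ = 0 → ∀ x ∈ Z, φ x = 0) ∧
      ∀ (η : g) (φ : Module.Dual k g),
        S (-(φ ∘ₗ (LieAlgebra.ad k g η : g →ₗ[k] g))) = ⁅η, S φ⁆ := by
  let e : Module.Dual k Z ≃ₗ[k] Z := LinearEquiv.ofFinrankEq _ _ Subspace.dual_finrank_eq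
  refine ⟨Z.subtype ∘ₗ e.toLinearMap ∘ₗ Z.subtype.dualMap, fun φ ↦ (e _).2,
    fun φ h x hx ↦ ?_, fun η φ ↦ ?_⟩
  · have h0 : Z.subtype.dualMap φ = 0 := e.map_eq_zero_iff.mp (Subtype.ext h)
    exact LinearMap.congr_fun h0 ⟨x, hx⟩
  · have h0 : Z.subtype.dualMap (-(φ ∘ₗ (LieAlgebra.ad k g η : g →ₗ[k] g))) = 0 := by
      ext z
      have hz : ⁅η, (z : g)⁆ = 0 := hZ z.2 η
      simp [hz]
    have h1 : ⁅η, (e (Z.subtype.dualMap φ) : g)⁆ = 0 := hZ (e _).2 η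
    simp only [LinearMap.comp_apply, h0, map_zero]
    exact h1.symm

/-- Every ideal `P` of a reductive `g` admits an equivariant map `S` from `g*` to `g` which is
injective on the functionals vanishing on `P` and whose range is disjoint from `P`. -/
lemma exists_equivariant_disjoint [CharZero k] [FiniteDimensional k g] {s : LieIdeal k g}
    (hs : ∀ A : LieIdeal k g, IsLieAbelian A → A ≤ s → A = ⊥)
    (hcompl : IsCompl (LieAlgebra.center k g) s) (P : LieIdeal k g) :
    ∃ S : Module.Dual k g →ₗ[k] g, (∀ φ, S φ ∈ P → (∀ x ∈ P, φ x = 0) → φ = 0) ∧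
      (∀ φ, S φ ∈ P → S φ = 0) ∧
      ∀ (η : g) (φ : Module.Dual k g),
        S (-(φ ∘ₗ (LieAlgebra.ad k g η : g →ₗ[k] g))) = ⁅η, S φ⁆ := by
  set I : LieIdeal k g := P ⊓ s with hI
  have hIc := isCompl_killingCompl_of_le hs I inf_le_right
  set J : LieIdeal k g := s ⊓ I.killingCompl k g with hJ
  have hIJ : I ⊔ J = s := by
    rw [hJ, inf_comm s, ← sup_inf_assoc_of_le _ (inf_le_right : I ≤ s), hIc.sup_eq_top, top_inf_eq]
  obtain ⟨Z, hZd, hZs⟩ := IsModularLattice.exists_disjoint_and_sup_eq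
    (inf_le_right : P.toSubmodule ⊓ (LieAlgebra.center k g).toSubmodule ≤ _)
  have hZ : Z ≤ (LieAlgebra.center k g).toSubmodule := hZs ▸ le_sup_right
  have hPJ : P ⊓ J = ⊥ := by
    rw [hJ, ← inf_assoc, ← hI, hIc.inf_eq_bot]
  have hdisj : ∀ j ∈ J, ∀ z ∈ Z, j + z ∈ P → j = 0 ∧ z = 0 := by
    intro j hj z hz hjz
    have hj0 : j = 0 := by
      have hjc : j ∈ LieAlgebra.center k g := by
        refine mem_center_of_forall_lie_eq_zero hcompl.sup_eq_top fun y _ ↦ ?_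
        have h1 : ⁅y, j⁆ ∈ P := by
          have h := P.lie_mem (x := y) hjz
          rwa [lie_add, hZ hz y, add_zero] at h
        have h2 : ⁅y, j⁆ ∈ P ⊓ J := ⟨h1, J.lie_mem hj⟩
        rwa [hPJ, LieSubmodule.mem_bot] at h2
      exact hcompl.disjoint.le_bot ⟨hjc, hj.1⟩
    subst hj0
    rw [zero_add] at hjz
    exact ⟨rfl, hZd.le_bot ⟨⟨hjz, hZ hz⟩, hz⟩⟩
  obtain ⟨S₁, h₁mem, h₁ker, h₁⟩ := exists_equivariant_of_disjoint_killingCompl J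
    (disjoint_killingCompl_of_le hs J inf_le_left)
  obtain ⟨S₂, h₂mem, h₂ker, h₂⟩ := exists_equivariant_of_le_center Z hZ
  refine ⟨S₁ + S₂, fun φ hφ hP ↦ ?_, fun φ hφ ↦ ?_, fun η φ ↦ ?_⟩
  · obtain ⟨h1, h2⟩ := hdisj _ (h₁mem φ) _ (h₂mem φ) hφ
    ext x
    obtain ⟨c, hc, t, ht, rfl⟩ :=
      (LieSubmodule.mem_sup _ _ x).mp (hcompl.sup_eq_top ▸ LieSubmodule.mem_top x)
    obtain ⟨i, hi, j, hj, rfl⟩ := (LieSubmodule.mem_sup _ _ t).mp (hIJ ▸ ht)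
    replace hc : c ∈ (LieAlgebra.center k g).toSubmodule := hc
    rw [← hZs] at hc
    obtain ⟨p, hp, z, hz, rfl⟩ := Submodule.mem_sup.mp hc
    simp [hP p hp.1, hP i hi.1, h₁ker φ h1 j hj, h₂ker φ h2 z hz]
  · obtain ⟨h1, h2⟩ := hdisj _ (h₁mem φ) _ (h₂mem φ) hφ
    simp [h1, h2]
  · simp only [LinearMap.add_apply, h₁, h₂, lie_add]

end Ideals

section Lagrangian

variable {k g : Type*} [Field k] [LieRing g] [LieAlgebra k g]

/-- The first projection of an invariant subspace, as an ideal. -/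
def fstIdeal (L : Submodule k (g × Module.Dual k g))
    (hinv : IsInvariant k g L) : LieIdeal k g where
  __ := L.map (LinearMap.fst k g (Module.Dual k g))
  lie_mem := by
    rintro η _ ⟨v, hv, rfl⟩
    exact ⟨adCoad k g η v, hinv η v hv, rfl⟩

lemma finrank_le_of_isLagrangian [FiniteDimensional k g] {L : Submodule k (g × Module.Dual k g)}
    (hlag : IsLagrangian k g L) : Module.finrank k g ≤ Module.finrank k L := by
  let Ω : (g × Module.Dual k g) →ₗ[k] Module.Dual k L :=
    LinearMap.mk₂ k (fun u (w : L) ↦ omegaV k g u w)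
      (fun _ _ _ ↦ by simp [omegaV]; ring) (fun _ _ _ ↦ by simp [omegaV]; ring)
      (fun _ _ _ ↦ by simp [omegaV]; ring) (fun _ _ _ ↦ by simp [omegaV]; ring)
  have hker : LinearMap.ker Ω = L := by
    ext v
    rw [hlag v, LinearMap.mem_ker, LinearMap.ext_iff]
    exact Subtype.forall
  have h := LinearMap.finrank_range_add_finrank_ker Ω
  rw [hker, Module.finrank_prod, Subspace.dual_finrank_eq] at h
  have h' := (Submodule.finrank_le (LinearMap.range Ω)).trans_eq
    (Subspace.dual_finrank_eq (K := k) (V := L))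
  lia

end Lagrangian

end QPar

/-- For every invariant Lagrangian subspace `L` of `V = 𝔤 ⊕ 𝔤*`, there
is a linear isomorphism `L ≅ 𝔤` commuting with the 𝔤-actions (adjoint–coadjoint on `L`,
adjoint on 𝔤); i.e. `L` and 𝔤 are (non-canonically) isomorphic as 𝔤-modules. -/
theorem statement1
    (k g : Type*) [Field k] [CharZero k] [IsAlgClosed k]
    [LieRing g] [LieAlgebra k g] [FiniteDimensional k g]
    (n : ℕ) (gi : Fin n → Submodule k g)
    (hsimple : ∀ i, QPar.IsSimpleIdeal k g (gi i))
    (hdec : DirectSum.IsInternal (fun o : Option (Fin n) => o.elim (QPar.centerS k g) gi))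
    (L : Submodule k (g × Module.Dual k g))
    (hinv : QPar.IsInvariant k g L) (hlag : QPar.IsLagrangian k g L) :
    ∃ e : ↥L ≃ₗ[k] g, ∀ (η : g) (v : ↥L),
      e ⟨QPar.adCoad k g η (v : g × Module.Dual k g), hinv η (v : g × Module.Dual k g) v.2⟩
        = ⁅η, e v⁆ := by
  let G (i : Fin n) : LieIdeal k g := { gi i with lie_mem := fun {x m} hm ↦ (hsimple i).1 x m hm }
  have hcompl : IsCompl (LieAlgebra.center k g) (⨆ i, G i) := by
    rw [← LieSubmodule.isCompl_toSubmodule, LieSubmodule.iSup_toSubmodule]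
    refine ⟨(hdec.submodule_iSupIndep none).mono_right (iSup_le fun i ↦ ?_), ?_⟩
    · exact le_iSup₂_of_le (some i) (Option.some_ne_none i) le_rfl
    · rw [codisjoint_iff, ← hdec.submodule_iSup_eq_top, iSup_option]
      rfl
  obtain ⟨S, hker, hzero, hS⟩ := QPar.exists_equivariant_disjoint
    (fun A _ hA ↦ QPar.eq_bot_of_isLieAbelian_of_le hsimple hcompl A hA) hcompl
    (QPar.fstIdeal L hinv)
  let F : L →ₗ[k] g := (LinearMap.fst k g (Module.Dual k g) +
    S ∘ₗ LinearMap.snd k g (Module.Dual k g)) ∘ₗ L.subtype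
  have hF : Function.Injective F := by
    rw [injective_iff_map_eq_zero]
    rintro ⟨⟨ξ, φ⟩, hv⟩ h
    replace h : ξ + S φ = 0 := h
    have hξ : ξ ∈ QPar.fstIdeal L hinv := ⟨_, hv, rfl⟩
    have hSφ : S φ ∈ QPar.fstIdeal L hinv := by
      rw [← neg_eq_of_add_eq_zero_right h]
      exact neg_mem hξ
    rw [hzero φ hSφ, add_zero] at h
    subst h
    have hφ : φ = 0 := hker φ hSφ <| by
      rintro _ ⟨w, hw, rfl⟩
      simpa [QPar.omegaV] using (hlag _).mp hv w hw
    subst hφ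
    rfl
  have hfin : Module.finrank k L = Module.finrank k g :=
    (LinearMap.finrank_le_finrank_of_injective hF).antisymm (QPar.finrank_le_of_isLagrangian hlag)
  refine ⟨LinearEquiv.ofBijective F
    ⟨hF, (LinearMap.injective_iff_surjective_of_finrank_eq_finrank (V := L) hfin).mp hF⟩,
    fun η v ↦ ?_⟩
  change ⁅η, (v : g × Module.Dual k g).1⁆ + S (-(_ ∘ₗ _)) = ⁅η, _ + S _⁆
  rw [hS, lie_add]
  rfl
end

section
/- Let p : V → V be the linear projection onto the summand 𝔷 ⊕ 𝔷* along (𝔤₁ ⊕ … ⊕ 𝔤ₙ) ⊕ (𝔤₁* ⊕ … ⊕ 𝔤ₙ*). Then for every invariant Lagrangian subspace L of V = 𝔤 ⊕ 𝔤*, p maps L into L, its image p(L) equals L ∩ (𝔷 ⊕ 𝔷*), and p restricted to L ∩ (𝔷 ⊕ 𝔷*) is the identity; in particular the inclusion L ∩ (𝔷 ⊕ 𝔷*) ↪ L admits a canonical linear retraction. -/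
namespace QPar

section StableComplements

variable {k ι M N : Type*} [Field k] [AddCommGroup M] [Module k M] [AddCommGroup N] [Module k N]

/-- Every subspace stable under the operators `f i` has a complement stable under them. -/
def HasStableCompl (f : ι → M →ₗ[k] M) : Prop :=
  ∀ W : Submodule k M, (∀ i, W ≤ W.comap (f i)) →
    ∃ W' : Submodule k M, (∀ i, W' ≤ W'.comap (f i)) ∧ IsCompl W W'

lemma HasStableCompl.neg_dualMap [FiniteDimensional k M] {f : ι → M →ₗ[k] M}
    (hf : HasStableCompl f) : HasStableCompl fun i => -(f i).dualMap := by
  intro W hW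
  obtain ⟨U, hU, hc⟩ := hf W.dualCoannihilator fun i x hx => by
    rw [Submodule.mem_comap, Submodule.mem_dualCoannihilator]
    intro φ hφ
    have := (Submodule.mem_dualCoannihilator x).1 hx _ (hW i hφ)
    simpa using this
  refine ⟨U.dualAnnihilator, fun i φ hφ => ?_, ?_⟩
  · rw [Submodule.mem_comap, Submodule.mem_dualAnnihilator]
    intro x hx
    simpa using (Submodule.mem_dualAnnihilator φ).1 hφ _ (hU i hx)
  · have := Subspace.isCompl_dualAnnihilator hc
    rwa [Subspace.dualCoannihilator_dualAnnihilator_eq] at this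

lemma HasStableCompl.prodMap {f : ι → M →ₗ[k] M} {h : ι → N →ₗ[k] N}
    (hf : HasStableCompl f) (hh : HasStableCompl h) :
    HasStableCompl fun i => (f i).prodMap (h i) := by
  intro W hW
  obtain ⟨A, hA, hAc⟩ := hf (W.comap (LinearMap.inl k M N)) fun i x hx => by
    simpa using hW i hx
  obtain ⟨B, hB, hBc⟩ := hh (W.map (LinearMap.snd k M N)) fun i y hy => by
    obtain ⟨w, hw, rfl⟩ := hy
    exact ⟨_, hW i hw, rfl⟩
  refine ⟨A.prod B, fun i v hv => ⟨hA i hv.1, hB i hv.2⟩, ?_, ?_⟩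
  · rw [Submodule.disjoint_def]
    rintro ⟨a, b⟩ hW' ⟨ha, hb⟩
    have hb0 : b = 0 := Submodule.disjoint_def.1 hBc.disjoint b ⟨_, hW', rfl⟩ hb
    subst hb0
    have ha0 : a = 0 := Submodule.disjoint_def.1 hAc.disjoint a hW' ha
    rw [ha0, Prod.mk_zero_zero]
  · rw [codisjoint_iff, eq_top_iff]
    rintro ⟨a, b⟩ -
    obtain ⟨_, ⟨w, hw, rfl⟩, b', hb', hwb⟩ :=
      Submodule.mem_sup.1 (hBc.sup_eq_top.ge (Submodule.mem_top (x := b)))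
    obtain ⟨a₁, ha₁, a', ha', haa⟩ :=
      Submodule.mem_sup.1 (hAc.sup_eq_top.ge (Submodule.mem_top (x := a - w.1)))
    refine Submodule.mem_sup.2 ⟨w + (a₁, 0), W.add_mem hw ha₁, (a', b'), ⟨ha', hb'⟩, ?_⟩
    ext
    · change w.1 + a₁ + a' = a
      rw [add_assoc, haa, add_sub_cancel]
    · change w.2 + 0 + b' = b
      rw [add_zero]
      exact hwb

/-- A stable subspace is the sum of the span of the images of the operators on it
and of the vectors in it killed by all the operators. -/
lemma HasStableCompl.exists_add_of_mem {f : ι → M →ₗ[k] M} (hf : HasStableCompl f)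
    {W : Submodule k M} (hW : ∀ i, W ≤ W.comap (f i)) {x : M} (hx : x ∈ W) :
    ∃ m ∈ ⨆ i, W.map (f i), ∃ c ∈ W, (∀ i, f i c = 0) ∧ m + c = x := by
  have hle : ⨆ i, W.map (f i) ≤ W := iSup_le fun i => Submodule.map_le_iff_le_comap.2 (hW i)
  obtain ⟨C, hC, hc⟩ := hf (⨆ i, W.map (f i)) fun i y hy =>
    Submodule.mem_iSup_of_mem i ⟨y, hle hy, rfl⟩
  obtain ⟨m, hm, c, hcC, rfl⟩ :=
    Submodule.mem_sup.1 (hc.sup_eq_top.ge (Submodule.mem_top (x := x)))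
  have hcW : c ∈ W := (W.add_mem_iff_right (hle hm)).1 hx
  exact ⟨m, hm, c, hcW, fun i => Submodule.disjoint_def.1 hc.disjoint _
    (Submodule.mem_iSup_of_mem i ⟨c, hcW, rfl⟩) (hC i hcC), rfl⟩

end StableComplements

section Reductive

variable {k g : Type*} [Field k] [LieRing g] [LieAlgebra k g]

lemma IsSimpleIdeal.isAtom {I : LieIdeal k g} (hI : IsSimpleIdeal k g I.toSubmodule) :
    IsAtom I := by
  obtain ⟨-, ⟨x, hx, y, hy, hxy⟩, hmin⟩ := hI
  refine ⟨?_, fun J hJ => ?_⟩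
  · rintro rfl
    have hx0 : x = 0 := hx
    simp [hx0] at hxy
  · rcases hmin J.toSubmodule hJ.le fun x _ y hy => J.lie_mem hy with h | h
    · exact (LieSubmodule.toSubmodule_eq_bot J).1 h
    · exact absurd (LieSubmodule.toSubmodule_injective h) hJ.ne

/-- A simple ideal is spanned by the brackets with its elements. -/
lemma IsSimpleIdeal.iSup_map_ad {I : Submodule k g} (hI : IsSimpleIdeal k g I) :
    ⨆ η : g, I.map (LieAlgebra.ad k g η : g →ₗ[k] g) = I := by
  obtain ⟨hst, ⟨x, hx, y, hy, hxy⟩, hmin⟩ := hI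
  have hle : ⨆ η : g, I.map (LieAlgebra.ad k g η : g →ₗ[k] g) ≤ I :=
    iSup_le fun η => Submodule.map_le_iff_le_comap.2 (hst η)
  refine (hmin _ hle fun a _ b hb => Submodule.mem_iSup_of_mem a ⟨b, hle hb, rfl⟩).resolve_left
    fun h => hxy ?_
  rw [← Submodule.mem_bot k, ← h]
  exact Submodule.mem_iSup_of_mem x ⟨y, hy, rfl⟩

lemma hasStableCompl_ad [FiniteDimensional k g] {ι : Type*} {gi : ι → Submodule k g}
    (hsimple : ∀ i, IsSimpleIdeal k g (gi i)) (htop : centerS k g ⊔ ⨆ i, gi i = ⊤) :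
    HasStableCompl fun η : g => (LieAlgebra.ad k g η : g →ₗ[k] g) := by
  have hatoms : sSup {a : LieIdeal k g | IsAtom a} = ⊤ := by
    rw [← LieSubmodule.toSubmodule_eq_top, eq_top_iff, ← htop]
    refine sup_le (fun z hz => ?_) (iSup_le fun i => ?_)
    · rcases eq_or_ne z 0 with rfl | hz0
      · exact zero_mem _
      have hz' : ∀ x : g, ⁅x, z⁆ = 0 := hz
      let Z : LieIdeal k g :=
        { Submodule.span k {z} with
          lie_mem := fun {x m} hm => by
            obtain ⟨c, rfl⟩ := Submodule.mem_span_singleton.1 hm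
            simp [hz' x] }
      have hZ : IsAtom Z := by
        have hspan := nonzero_span_atom (K := k) z hz0
        refine ⟨fun h => hspan.1 (congrArg LieSubmodule.toSubmodule h), fun J hJ => ?_⟩
        exact (LieSubmodule.toSubmodule_eq_bot J).1 (hspan.2 J.toSubmodule hJ)
      exact (le_sSup hZ : Z ≤ sSup {a : LieIdeal k g | IsAtom a})
        (Submodule.mem_span_singleton_self z)
    · let I : LieIdeal k g := { gi i with lie_mem := fun {x m} hm => (hsimple i).1 x m hm }
      have hI : IsAtom I := (hsimple i).isAtom (I := I)
      exact (le_sSup hI : I ≤ sSup {a : LieIdeal k g | IsAtom a})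
  have := complementedLattice_of_sSup_atoms_eq_top hatoms
  intro W hW
  let J : LieIdeal k g := { W with lie_mem := fun {x m} hm => hW x hm }
  obtain ⟨J', hJ'⟩ := exists_isCompl J
  exact ⟨J'.toSubmodule, fun η x hx => J'.lie_mem hx, LieSubmodule.isCompl_toSubmodule.2 hJ'⟩

end Reductive

section Decomposition

variable {k g : Type*} [Field k] [LieRing g] [LieAlgebra k g] {n : ℕ}
  {gi : Fin n → Submodule k g}

lemma centerS_sup_iSup_eq_top
    (hdec : DirectSum.IsInternal (fun o : Option (Fin n) => o.elim (centerS k g) gi)) :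
    centerS k g ⊔ ⨆ i, gi i = ⊤ := by
  rw [← hdec.submodule_iSup_eq_top, iSup_option]
  rfl

lemma iInf_centerS_sup_le
    (hdec : DirectSum.IsInternal (fun o : Option (Fin n) => o.elim (centerS k g) gi)) :
    ⨅ i, (centerS k g ⊔ ⨆ j, ⨆ _ : j ≠ i, gi j) ≤ centerS k g := by
  classical
  let A : Option (Fin n) → Submodule k g := fun o => o.elim (centerS k g) gi
  let _ : DirectSum.Decomposition A := DirectSum.IsInternal.chooseDecomposition _ hdec
  intro x hx
  rw [Submodule.mem_iInf] at hx
  have hzero : ∀ i, DirectSum.decompose A x (some i) = 0 := by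
    intro i
    have hle : centerS k g ⊔ ⨆ j, ⨆ _ : j ≠ i, gi j ≤
        LinearMap.ker (DirectSum.component k _ (fun o => A o) (some i) ∘ₗ
          (DirectSum.decomposeLinearEquiv A : g →ₗ[k] _)) := by
      refine sup_le (fun y hy => ?_) (iSup₂_le fun j hj y hy => ?_)
      · exact Subtype.ext (DirectSum.decompose_of_mem_ne A (i := none) hy (by simp))
      · exact Subtype.ext (DirectSum.decompose_of_mem_ne A (i := some j) hy (by simpa using hj))
    exact hle (hx i)
  rw [← DirectSum.sum_support_decompose A x]
  refine sum_mem fun o _ => ?_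
  cases o with
  | none => exact (DirectSum.decompose A x none).2
  | some i => rw [hzero i]; exact zero_mem _

lemma dualAnnihilator_centerS_le [FiniteDimensional k g]
    (hdec : DirectSum.IsInternal (fun o : Option (Fin n) => o.elim (centerS k g) gi)) :
    (centerS k g).dualAnnihilator ≤ ⨆ i, giDual k g gi i := by
  have := Submodule.dualAnnihilator_anti (iInf_centerS_sup_le hdec)
  rwa [Subspace.dualAnnihilator_iInf_eq] at this

lemma adCoad_mem_prod [FiniteDimensional k g]
    (hsimple : ∀ i, IsSimpleIdeal k g (gi i))
    (hdec : DirectSum.IsInternal (fun o : Option (Fin n) => o.elim (centerS k g) gi))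
    (η : g) (v : g × Module.Dual k g) :
    adCoad k g η v ∈ (⨆ i, gi i).prod (⨆ i, giDual k g gi i) := by
  constructor
  · have hle : centerS k g ⊔ ⨆ i, gi i ≤
        (⨆ i, gi i).comap (LieAlgebra.ad k g η : g →ₗ[k] g) := by
      refine sup_le (fun z hz => ?_) (iSup_le fun i x hx => ?_)
      · have hz' : ⁅η, z⁆ = 0 := hz η
        simp [hz']
      · exact Submodule.mem_iSup_of_mem i ((hsimple i).1 η x hx)
    rw [centerS_sup_iSup_eq_top hdec] at hle
    exact hle Submodule.mem_top
  · refine dualAnnihilator_centerS_le hdec ((Submodule.mem_dualAnnihilator _).2 fun z hz => ?_)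
    have hz' : ⁅η, z⁆ = 0 := hz η
    simp [adCoad, hz']

lemma mem_zPart_of_adCoad_eq_zero (hsimple : ∀ i, IsSimpleIdeal k g (gi i))
    {v : g × Module.Dual k g} (hv : ∀ η, adCoad k g η v = 0) : v ∈ zPart k g gi := by
  refine ⟨fun η => congrArg Prod.fst (hv η), (Submodule.mem_dualAnnihilator _).2 ?_⟩
  have hle : ⨆ i, gi i ≤ LinearMap.ker v.2 := by
    refine iSup_le fun i => ?_
    rw [← (hsimple i).iSup_map_ad]
    refine iSup_le fun η => ?_
    rintro _ ⟨x, -, rfl⟩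
    simpa [adCoad] using LinearMap.congr_fun (congrArg Prod.snd (hv η)) x
  exact fun x hx => hle hx

end Decomposition

end QPar

/-- Let `p : V → V` be the linear projection onto the summand `𝔷 ⊕ 𝔷*`
along `(𝔤₁ ⊕ … ⊕ 𝔤ₙ) ⊕ (𝔤₁* ⊕ … ⊕ 𝔤ₙ*)`. Then for every invariant Lagrangian subspace
`L` of `V`, `p` maps `L` into `L`, its image `p(L)` equals `L ∩ (𝔷 ⊕ 𝔷*)`, and `p`
restricted to `L ∩ (𝔷 ⊕ 𝔷*)` is the identity; in particular the inclusion
`L ∩ (𝔷 ⊕ 𝔷*) ↪ L` admits a canonical linear retraction. -/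
theorem statement3
    (k g : Type*) [Field k] [CharZero k] [IsAlgClosed k]
    [LieRing g] [LieAlgebra k g] [FiniteDimensional k g]
    (n : ℕ) (gi : Fin n → Submodule k g)
    (hsimple : ∀ i, QPar.IsSimpleIdeal k g (gi i))
    (hdec : DirectSum.IsInternal (fun o : Option (Fin n) => o.elim (QPar.centerS k g) gi))
    (p : (g × Module.Dual k g) →ₗ[k] (g × Module.Dual k g))
    (hp1 : ∀ v ∈ QPar.zPart k g gi, p v = v)
    (hp2 : ∀ v ∈ ((⨆ i, gi i).prod (⨆ i, QPar.giDual k g gi i) :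
        Submodule k (g × Module.Dual k g)), p v = 0)
    (L : Submodule k (g × Module.Dual k g))
    (hinv : QPar.IsInvariant k g L) (hlag : QPar.IsLagrangian k g L) :
    (∀ v ∈ L, p v ∈ L) ∧
    Submodule.map p L = L ⊓ QPar.zPart k g gi ∧
    (∀ v ∈ L ⊓ QPar.zPart k g gi, p v = v) ∧
    ∃ r : ↥L →ₗ[k] ↥(L ⊓ QPar.zPart k g gi),
      r ∘ₗ Submodule.inclusion (inf_le_left : L ⊓ QPar.zPart k g gi ≤ L) = LinearMap.id := by
  have hcompl : QPar.HasStableCompl fun η : g =>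
      (LieAlgebra.ad k g η : g →ₗ[k] g).prodMap (-(LieAlgebra.ad k g η : g →ₗ[k] g).dualMap) :=
    let had := QPar.hasStableCompl_ad hsimple (QPar.centerS_sup_iSup_eq_top hdec)
    had.prodMap had.neg_dualMap
  have hmem : ∀ v ∈ L, p v ∈ L ⊓ QPar.zPart k g gi := by
    intro v hv
    obtain ⟨m, hm, c, hcL, hc, rfl⟩ := hcompl.exists_add_of_mem (W := L) hinv hv
    have hcz : c ∈ QPar.zPart k g gi := QPar.mem_zPart_of_adCoad_eq_zero hsimple hc
    have hpm : p m = 0 := by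
      refine hp2 m (SetLike.le_def.1 (iSup_le fun η => ?_) hm)
      rintro _ ⟨w, -, rfl⟩
      exact QPar.adCoad_mem_prod hsimple hdec η w
    rw [map_add, hpm, zero_add, hp1 c hcz]
    exact ⟨hcL, hcz⟩
  refine ⟨fun v hv => (hmem v hv).1, le_antisymm ?_ ?_, fun v hv => hp1 v hv.2,
    p.restrict hmem, ?_⟩
  · rintro _ ⟨v, hv, rfl⟩
    exact hmem v hv
  · exact fun v hv => ⟨v, hv.1, hp1 v hv.2⟩
  · ext1 v
    exact Subtype.ext (hp1 v v.2.2)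
end

section
/- Assume in addition that k is algebraically closed and 𝔤 is a simple Lie algebra, and let κ♯ : 𝔤 → 𝔤* be given by the Killing form, κ♯(ξ) = killingForm(ξ, ·). Then a subspace L ⊆ V = 𝔤 ⊕ 𝔤* is an invariant Lagrangian subspace if and only if either L = 0 ⊕ 𝔤* or L = Γ(c · κ♯) := {(ξ, c·κ♯ ξ) : ξ ∈ 𝔤} for some scalar c ∈ k; moreover the scalar c is uniquely determined by L, and no graph Γ(c · κ♯) equals 0 ⊕ 𝔤*. (Thus the invariant Lagrangian subspaces form a copy of k together with one point at infinity.) -/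
namespace QPar

section Schur

variable {k g : Type*} [Field k] [LieRing g] [LieAlgebra k g] [LieAlgebra.IsSimple k g]

/-- A nonzero subspace of a simple Lie algebra which is stable under the adjoint action is
the whole Lie algebra. -/
theorem eq_top_of_lie_mem {P : Submodule k g} (hP : ∀ η : g, ∀ ξ ∈ P, ⁅η, ξ⁆ ∈ P)
    (hne : P ≠ ⊥) : P = ⊤ := by
  let I : LieIdeal k g := { P with lie_mem := fun {η ξ} h => hP η ξ h }
  have hI : I.toSubmodule = P := rfl
  rcases LieAlgebra.IsSimple.eq_bot_or_eq_top (R := k) I with h | h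
  · exact absurd (by rw [← hI, h, LieSubmodule.bot_toSubmodule]) hne
  · rw [← hI, h, LieSubmodule.top_toSubmodule]

theorem nontrivial_of_isSimple (k g : Type*) [Field k] [LieRing g] [LieAlgebra k g]
    [LieAlgebra.IsSimple k g] : Nontrivial g := by
  by_contra h
  rw [not_nontrivial_iff_subsingleton] at h
  exact LieAlgebra.IsSimple.non_abelian (R := k) (L := g) inferInstance

/-- Schur's lemma for the adjoint representation of a simple Lie algebra. -/
theorem exists_eq_smul_of_map_lie [IsAlgClosed k] [FiniteDimensional k g]
    (T : Module.End k g) (hT : ∀ η ξ : g, T ⁅η, ξ⁆ = ⁅η, T ξ⁆) :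
    ∃ c : k, ∀ ξ, T ξ = c • ξ := by
  have := nontrivial_of_isSimple k g
  obtain ⟨c, hc⟩ := Module.End.exists_eigenvalue T
  have htop : T.eigenspace c = ⊤ := by
    refine eq_top_of_lie_mem (fun η ξ hξ => ?_) hc
    rw [Module.End.mem_eigenspace_iff] at hξ ⊢
    rw [hT, hξ, lie_smul]
  exact ⟨c, fun ξ => Module.End.mem_eigenspace_iff.mp (htop ▸ Submodule.mem_top)⟩

/-- Every invariant bilinear form on a simple Lie algebra is a multiple of the Killing form. -/
theorem exists_eq_smul_killingForm [CharZero k] [IsAlgClosed k] [FiniteDimensional k g]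
    (f : g →ₗ[k] Module.Dual k g) (hf : ∀ η ξ ζ : g, f ⁅η, ξ⁆ ζ = - f ξ ⁅η, ζ⁆) :
    ∃ c : k, f = c • (killingForm k g : g →ₗ[k] Module.Dual k g) := by
  have hκ := LieAlgebra.IsKilling.killingForm_nondegenerate k g
  let e := LinearMap.BilinForm.toDual (killingForm k g) hκ
  have he : ∀ x y, e x y = killingForm k g x y := fun x y =>
    LinearMap.BilinForm.toDual_def hκ
  obtain ⟨c, hc⟩ := exists_eq_smul_of_map_lie (e.symm.toLinearMap ∘ₗ f) (fun η ξ => by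
    apply e.injective
    ext ζ
    simp only [LinearMap.comp_apply, LinearEquiv.coe_coe, LinearEquiv.apply_symm_apply]
    rw [hf, he, LieModule.traceForm_apply_lie_apply', ← he, LinearEquiv.apply_symm_apply])
  refine ⟨c, LinearMap.ext fun ξ => ?_⟩
  have h := congrArg e (hc ξ)
  simp only [LinearMap.comp_apply, LinearEquiv.coe_coe, LinearEquiv.apply_symm_apply,
    map_smul] at h
  rw [h]
  ext ζ
  simp [he]

end Schur

section Lagrangian

variable {k g : Type*} [Field k] [LieRing g] [LieAlgebra k g]

theorem isInvariant_bot_prod_top :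
    IsInvariant k g ((⊥ : Submodule k g).prod (⊤ : Submodule k (Module.Dual k g))) := by
  rintro η ⟨ξ, φ⟩ h
  simp_all [adCoad]

theorem isLagrangian_bot_prod_top :
    IsLagrangian k g ((⊥ : Submodule k g).prod (⊤ : Submodule k (Module.Dual k g))) := by
  rintro ⟨ξ, φ⟩
  simp only [Submodule.mem_prod, Submodule.mem_bot, Submodule.mem_top, and_true, omegaV]
  refine ⟨fun h w hw => by simp [h, hw], fun h => ?_⟩
  refine (Module.forall_dual_apply_eq_zero_iff k ξ).mp fun ψ => ?_
  simpa using h (0, ψ) rfl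

theorem isInvariant_graph_iff (f : g →ₗ[k] Module.Dual k g) :
    IsInvariant k g f.graph ↔ ∀ η ξ ζ : g, f ⁅η, ξ⁆ ζ = - f ξ ⁅η, ζ⁆ := by
  constructor
  · intro h η ξ ζ
    have := h η (ξ, f ξ) (by simp)
    rw [LinearMap.mem_graph_iff] at this
    simpa [adCoad] using (LinearMap.congr_fun this ζ).symm
  · rintro h η ⟨ξ, φ⟩ hv
    rw [LinearMap.mem_graph_iff] at hv ⊢
    ext ζ
    simp_all [adCoad]

theorem isLagrangian_graph {f : g →ₗ[k] Module.Dual k g} (hf : ∀ ξ ζ, f ξ ζ = f ζ ξ) :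
    IsLagrangian k g f.graph := by
  rintro ⟨ξ, φ⟩
  simp only [LinearMap.mem_graph_iff, omegaV]
  constructor
  · rintro rfl w hw
    simp [hw, hf ξ w.1]
  · intro h
    ext ζ
    simpa [sub_eq_zero, hf ξ ζ] using h (ζ, f ζ) rfl

theorem IsInvariant.lie_mem_map_fst {L : Submodule k (g × Module.Dual k g)}
    (hL : IsInvariant k g L) (η ξ : g) (hξ : ξ ∈ L.map (LinearMap.fst k g (Module.Dual k g))) :
    ⁅η, ξ⁆ ∈ L.map (LinearMap.fst k g (Module.Dual k g)) := by
  obtain ⟨v, hv, rfl⟩ := hξ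
  exact ⟨_, hL η v hv, rfl⟩

theorem IsLagrangian.eq_bot_prod_top {L : Submodule k (g × Module.Dual k g)}
    (hL : IsLagrangian k g L) (h : L.map (LinearMap.fst k g (Module.Dual k g)) = ⊥) :
    L = (⊥ : Submodule k g).prod (⊤ : Submodule k (Module.Dual k g)) := by
  have h0 : ∀ v ∈ L, v.1 = 0 := fun v hv =>
    (Submodule.mem_bot k).mp (h ▸ Submodule.mem_map_of_mem hv)
  ext v
  simp only [Submodule.mem_prod, Submodule.mem_bot, Submodule.mem_top, and_true]
  exact ⟨h0 v, fun hv => (hL v).mpr fun w hw => by simp [omegaV, hv, h0 w hw]⟩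

theorem IsLagrangian.exists_eq_graph {L : Submodule k (g × Module.Dual k g)}
    (hL : IsLagrangian k g L) (h : L.map (LinearMap.fst k g (Module.Dual k g)) = ⊤) :
    ∃ f : g →ₗ[k] Module.Dual k g, L = f.graph := by
  have hsurj : ∀ ξ : g, ∃ v ∈ L, v.1 = ξ := fun ξ =>
    Submodule.mem_map.mp (h ▸ Submodule.mem_top (x := ξ))
  refine Submodule.exists_eq_graph ⟨?_, fun ξ => ?_⟩
  · rintro ⟨v, hv⟩ ⟨w, hw⟩ hvw
    replace hvw : v.1 = w.1 := hvw
    refine Subtype.ext (Prod.ext hvw (LinearMap.ext fun ζ => ?_))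
    obtain ⟨u, hu, rfl⟩ := hsurj ζ
    have := (hL (v - w)).mp (L.sub_mem hv hw) u hu
    simpa [omegaV, hvw, sub_eq_zero] using this
  · obtain ⟨v, hv, rfl⟩ := hsurj ξ
    exact ⟨⟨v, hv⟩, rfl⟩

end Lagrangian

end QPar

/-- Assume `k` algebraically closed and 𝔤 simple; let
`κ♯ : 𝔤 → 𝔤*` be given by the Killing form. A subspace `L ⊆ V = 𝔤 ⊕ 𝔤*` is an invariant
Lagrangian subspace iff `L = 0 ⊕ 𝔤*` or `L = Γ(c·κ♯)` for some `c ∈ k`; moreover `c` is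
uniquely determined by `L`, and no graph `Γ(c·κ♯)` equals `0 ⊕ 𝔤*`. -/
theorem statement5
    (k g : Type*) [Field k] [CharZero k] [IsAlgClosed k]
    [LieRing g] [LieAlgebra k g] [FiniteDimensional k g] [LieAlgebra.IsSimple k g] :
    (∀ L : Submodule k (g × Module.Dual k g),
      (QPar.IsInvariant k g L ∧ QPar.IsLagrangian k g L) ↔
        (L = (⊥ : Submodule k g).prod (⊤ : Submodule k (Module.Dual k g)) ∨
          ∃ c : k, L = LinearMap.graph (c • (killingForm k g : g →ₗ[k] Module.Dual k g)))) ∧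
    (∀ c c' : k,
      LinearMap.graph (c • (killingForm k g : g →ₗ[k] Module.Dual k g)) =
        LinearMap.graph (c' • (killingForm k g : g →ₗ[k] Module.Dual k g)) → c = c') ∧
    (∀ c : k,
      LinearMap.graph (c • (killingForm k g : g →ₗ[k] Module.Dual k g)) ≠
        (⊥ : Submodule k g).prod (⊤ : Submodule k (Module.Dual k g))) := by
  have := QPar.nontrivial_of_isSimple k g
  refine ⟨fun L => ⟨?_, ?_⟩, fun c c' h => ?_, fun c h => ?_⟩
  · rintro ⟨hinv, hlag⟩
    by_cases hP : L.map (LinearMap.fst k g (Module.Dual k g)) = ⊥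
    · exact Or.inl (hlag.eq_bot_prod_top hP)
    · obtain ⟨f, rfl⟩ := hlag.exists_eq_graph (QPar.eq_top_of_lie_mem hinv.lie_mem_map_fst hP)
      obtain ⟨c, rfl⟩ :=
        QPar.exists_eq_smul_killingForm f ((QPar.isInvariant_graph_iff f).mp hinv)
      exact Or.inr ⟨c, rfl⟩
  · rintro (rfl | ⟨c, rfl⟩)
    · exact ⟨QPar.isInvariant_bot_prod_top, QPar.isLagrangian_bot_prod_top⟩
    · refine ⟨(QPar.isInvariant_graph_iff _).mpr fun η ξ ζ => ?_,
        QPar.isLagrangian_graph fun ξ ζ => ?_⟩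
      · simp only [LinearMap.smul_apply]
        rw [LieModule.traceForm_apply_lie_apply', smul_neg]
      · simp only [LinearMap.smul_apply]
        rw [LieModule.traceForm_comm]
  · obtain ⟨ξ, hξ⟩ := exists_ne (0 : g)
    have hmem : (ξ, (c • (killingForm k g : g →ₗ[k] Module.Dual k g)) ξ) ∈
        LinearMap.graph (c' • (killingForm k g : g →ₗ[k] Module.Dual k g)) := h ▸ by simp
    rw [LinearMap.mem_graph_iff] at hmem
    have hκ : killingForm k g ξ ≠ 0 := by
      rwa [Ne, ← LinearMap.mem_ker, LieAlgebra.IsKilling.ker_killingForm_eq_bot,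
        Submodule.mem_bot]
    exact smul_left_injective k hκ hmem
  · obtain ⟨ξ, hξ⟩ := exists_ne (0 : g)
    have hmem : (ξ, (c • (killingForm k g : g →ₗ[k] Module.Dual k g)) ξ) ∈
        (⊥ : Submodule k g).prod (⊤ : Submodule k (Module.Dual k g)) := h ▸ by simp
    exact hξ hmem.1
end

section
/- Let L be an invariant isotropic subspace of V = 𝔤 ⊕ 𝔤*. Then: (a) for all (ξ,φ), (ξ',φ') ∈ L the element (⁅ξ,ξ'⁆, −φ'∘ad(ξ)) again lies in L; (b) the bracket ⁅(ξ,φ),(ξ',φ')⁆ := (⁅ξ,ξ'⁆, −φ'∘ad(ξ)) is bilinear, alternating, and satisfies the Jacobi identity, so it makes L into a Lie algebra over k; (c) the first projection L → 𝔤, (ξ,φ) ↦ ξ, is a homomorphism of Lie algebras. -/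
namespace QPar

variable (k g : Type*) [Field k] [LieRing g] [LieAlgebra k g]

/-- The bracket `⁅(ξ,φ),(ξ',φ')⁆ := (⁅ξ,ξ'⁆, −φ'∘ad(ξ))` on V = 𝔤 ⊕ 𝔤*. -/
def brL (u v : g × Module.Dual k g) : g × Module.Dual k g :=
  (⁅u.1, v.1⁆, - (v.2 ∘ₗ (LieAlgebra.ad k g u.1 : g →ₗ[k] g)))

end QPar

namespace QPar

section Bracket

variable {k g : Type*} [Field k] [LieRing g] [LieAlgebra k g]

theorem brL_smul_add_left (c : k) (u u' v : g × Module.Dual k g) :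
    brL k g (c • u + u') v = c • brL k g u v + brL k g u' v := by
  ext x
  · simp [brL]
  · simp [brL]
    ring

theorem brL_smul_add_right (c : k) (u v v' : g × Module.Dual k g) :
    brL k g u (c • v + v') = c • brL k g u v + brL k g u v' := by
  ext x
  · simp [brL]
  · simp [brL]
    ring

/-- The bracket satisfies the left Leibniz identity on all of `V`. -/
theorem brL_brL_left (u v w : g × Module.Dual k g) :
    brL k g (brL k g u v) w = brL k g u (brL k g v w) - brL k g v (brL k g u w) := by
  ext x
  · simp [brL]
  · simp [brL]

variable {L : Submodule k (g × Module.Dual k g)}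

theorem IsInvariant.brL_mem (hinv : IsInvariant k g L) (u : g × Module.Dual k g)
    {v : g × Module.Dual k g} (hv : v ∈ L) : brL k g u v ∈ L :=
  hinv u.1 v hv

/-- On an invariant isotropic subspace the bracket is skew-symmetric. -/
theorem IsInvariant.brL_skew (hinv : IsInvariant k g L)
    (hiso : ∀ u ∈ L, ∀ v ∈ L, omegaV k g u v = 0) {u v : g × Module.Dual k g}
    (hu : u ∈ L) (hv : v ∈ L) : brL k g u v = -brL k g v u := by
  ext x
  · simp [brL]
  · have h : -u.2 ⁅x, v.1⁆ - v.2 ⁅x, u.1⁆ = 0 := hiso _ (hinv x u hu) v hv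
    rw [← lie_skew x v.1, ← lie_skew x u.1, map_neg, map_neg] at h
    simp only [brL, Prod.snd_neg, LinearMap.coe_comp, Function.comp_apply,
      LinearMap.neg_apply, LieAlgebra.ad_apply]
    linear_combination -h

end Bracket

end QPar

/-- Let `L` be an invariant isotropic subspace of `V = 𝔤 ⊕ 𝔤*`. Then:
(a) `L` is closed under the bracket `⁅(ξ,φ),(ξ',φ')⁆ := (⁅ξ,ξ'⁆, −φ'∘ad(ξ))`;
(b) this bracket is bilinear, alternating and satisfies the Jacobi identity on `L`, so
it makes `L` into a Lie algebra over `k`;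
(c) the first projection `L → 𝔤` is a homomorphism of Lie algebras. -/
theorem statement6
    (k g : Type*) [Field k] [CharZero k]
    [LieRing g] [LieAlgebra k g] [FiniteDimensional k g]
    (L : Submodule k (g × Module.Dual k g))
    (hinv : QPar.IsInvariant k g L)
    (hiso : ∀ u ∈ L, ∀ v ∈ L, QPar.omegaV k g u v = 0) :
    -- (a) closure under the bracket
    (∀ u ∈ L, ∀ v ∈ L, QPar.brL k g u v ∈ L) ∧
    -- (b) bilinearity …
    (∀ (c : k), ∀ u ∈ L, ∀ u' ∈ L, ∀ v ∈ L,
      QPar.brL k g (c • u + u') v = c • QPar.brL k g u v + QPar.brL k g u' v) ∧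
    (∀ (c : k), ∀ u ∈ L, ∀ v ∈ L, ∀ v' ∈ L,
      QPar.brL k g u (c • v + v') = c • QPar.brL k g u v + QPar.brL k g u v') ∧
    -- … alternating …
    (∀ u ∈ L, QPar.brL k g u u = 0) ∧
    -- … and the Jacobi identity, so that `L` is a Lie algebra over `k`
    (∀ u ∈ L, ∀ v ∈ L, ∀ w ∈ L,
      QPar.brL k g (QPar.brL k g u v) w + QPar.brL k g (QPar.brL k g v w) u +
        QPar.brL k g (QPar.brL k g w u) v = 0) ∧
    -- (c) the first projection is a Lie algebra homomorphism
    (∀ u ∈ L, ∀ v ∈ L, (QPar.brL k g u v).1 = ⁅u.1, v.1⁆) := by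
  have skew {u v : g × Module.Dual k g} (hu : u ∈ L) (hv : v ∈ L) :=
    hinv.brL_skew hiso hu hv
  refine ⟨fun u _ v hv => hinv.brL_mem u hv,
    fun c u _ u' _ v _ => QPar.brL_smul_add_left c u u' v,
    fun c u _ v _ v' _ => QPar.brL_smul_add_right c u v v',
    fun u hu => ?_, fun u hu v hv w hw => ?_, fun _ _ _ _ => rfl⟩
  · have h : (2 : k) • QPar.brL k g u u = 0 := by
      rw [two_smul, ← eq_neg_iff_add_eq_zero]
      exact skew hu hu
    exact (smul_eq_zero.mp h).resolve_left two_ne_zero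
  have neg_right (a b : g × Module.Dual k g) : QPar.brL k g a (-b) = -QPar.brL k g a b := by
    simp [QPar.brL]
  rw [QPar.brL_brL_left, skew (hinv.brL_mem v hw) hu, skew (hinv.brL_mem w hu) hv,
    skew hw hu, neg_right]
  abel
end

section
/- Let L be an invariant isotropic subspace of V = 𝔤 ⊕ 𝔤*, equipped with the Lie bracket ⁅(ξ,φ),(ξ',φ')⁆ := (⁅ξ,ξ'⁆, −φ'∘ad(ξ)). Then every element of L of the form (0,φ) is central in L; equivalently, the kernel of the projection L → 𝔤 onto the first factor is contained in the center of the Lie algebra L. -/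
/-- Let `L` be an invariant isotropic subspace of `V = 𝔤 ⊕ 𝔤*`, with
the Lie bracket `⁅(ξ,φ),(ξ',φ')⁆ := (⁅ξ,ξ'⁆, −φ'∘ad(ξ))`. Then every element of `L` of
the form `(0,φ)` is central in `L`: the kernel of the projection `L → 𝔤` is contained
in the center of the Lie algebra `L`. -/
theorem statement7
    (k g : Type*) [Field k] [CharZero k]
    [LieRing g] [LieAlgebra k g] [FiniteDimensional k g]
    (L : Submodule k (g × Module.Dual k g))
    (hinv : QPar.IsInvariant k g L)
    (hiso : ∀ u ∈ L, ∀ v ∈ L, QPar.omegaV k g u v = 0) :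
    ∀ u ∈ L, u.1 = 0 → ∀ v ∈ L, QPar.brL k g u v = 0 ∧ QPar.brL k g v u = 0 := by
  intro u hu hu₁ v hv
  refine ⟨by simp [QPar.brL, hu₁], ?_⟩
  have hvanish (η : g) : u.2 ⁅v.1, η⁆ = 0 := by
    have h := hiso u hu _ (hinv η v hv)
    rw [← lie_skew, map_neg, neg_eq_zero]
    simpa [QPar.omegaV, QPar.adCoad, hu₁] using h
  refine Prod.ext (by simp [QPar.brL, hu₁]) ?_
  ext η
  simp [QPar.brL, hvanish]
end

section
/- The bilinear map c is a 2-cocycle on the loop algebra A ⊗_k 𝔩: (a) c is skew-symmetric, c(u,v) = −c(v,u) for all u, v ∈ A ⊗ 𝔩; and (b) c(⁅u,v⁆,w) + c(⁅v,w⁆,u) + c(⁅w,u⁆,v) = 0 for all u, v, w ∈ A ⊗ 𝔩. Consequently the bracket ⁅(s,u),(t,v)⁆ := (c(u,v), ⁅u,v⁆) makes k ⊕ (A ⊗ 𝔩) into a Lie algebra over k, a central extension of A ⊗ 𝔩 by k (the generalized Kac–Moody extension). -/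
open scoped TensorProduct

namespace QPar

variable (k A 𝔩 : Type*) [Field k] [CommRing A] [Algebra k A]
  [LieRing 𝔩] [LieAlgebra k 𝔩]

/-- The bracket `⁅(s,u),(t,v)⁆ := (c(u,v), ⁅u,v⁆)` on `k ⊕ (A ⊗ 𝔩)` determined by a
2-cochain `c` on the loop algebra `A ⊗ 𝔩`. -/
noncomputable def extBr (c : (A ⊗[k] 𝔩) →ₗ[k] (A ⊗[k] 𝔩) →ₗ[k] k)
    (p q : k × (A ⊗[k] 𝔩)) : k × (A ⊗[k] 𝔩) :=
  (c p.2 q.2, ⁅p.2, q.2⁆)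

end QPar

/-- A bilinear map on `A ⊗ 𝔩` given on pure tensors by `B x y * res (D f * g)`, for a symmetric
form `B` and a residue `res` killing derivatives, is skew-symmetric. -/
theorem QPar.residue_pairing_skew
    {k A 𝔩 : Type*} [Field k] [CommRing A] [Algebra k A] [LieRing 𝔩] [LieAlgebra k 𝔩]
    {D : A →ₗ[k] A} (hD : ∀ f g : A, D (f * g) = D f * g + f * D g)
    {res : A →ₗ[k] k} (hres : ∀ f : A, res (D f) = 0)
    {B : 𝔩 →ₗ[k] 𝔩 →ₗ[k] k} (hBsymm : ∀ x y : 𝔩, B x y = B y x)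
    {c : (A ⊗[k] 𝔩) →ₗ[k] (A ⊗[k] 𝔩) →ₗ[k] k}
    (hc : ∀ (f g : A) (x y : 𝔩), c (f ⊗ₜ[k] x) (g ⊗ₜ[k] y) = B x y * res (D f * g))
    (u v : A ⊗[k] 𝔩) : c u v = - c v u := by
  induction u with
  | zero => simp
  | add u₁ u₂ h₁ h₂ => simp only [map_add, LinearMap.add_apply, h₁, h₂, neg_add]
  | tmul f x =>
    induction v with
    | zero => simp
    | add v₁ v₂ h₁ h₂ => simp only [map_add, LinearMap.add_apply, h₁, h₂, neg_add]
    | tmul g y =>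
      have h := hres (f * g)
      rw [hD, map_add, mul_comm f] at h
      rw [hc, hc, hBsymm y x, eq_neg_of_add_eq_zero_left h, mul_neg]

/-- The residue pairing attached to an invariant symmetric form satisfies the 2-cocycle identity
on the loop algebra. -/
theorem QPar.residue_pairing_cocycle
    {k A 𝔩 : Type*} [Field k] [CommRing A] [Algebra k A] [LieRing 𝔩] [LieAlgebra k 𝔩]
    {D : A →ₗ[k] A} (hD : ∀ f g : A, D (f * g) = D f * g + f * D g)
    {res : A →ₗ[k] k} (hres : ∀ f : A, res (D f) = 0)
    {B : 𝔩 →ₗ[k] 𝔩 →ₗ[k] k} (hBsymm : ∀ x y : 𝔩, B x y = B y x)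
    (hBinv : ∀ x y z : 𝔩, B ⁅x, y⁆ z = B x ⁅y, z⁆)
    {c : (A ⊗[k] 𝔩) →ₗ[k] (A ⊗[k] 𝔩) →ₗ[k] k}
    (hc : ∀ (f g : A) (x y : 𝔩), c (f ⊗ₜ[k] x) (g ⊗ₜ[k] y) = B x y * res (D f * g))
    (u v w : A ⊗[k] 𝔩) : c ⁅u, v⁆ w + c ⁅v, w⁆ u + c ⁅w, u⁆ v = 0 := by
  induction u with
  | zero => simp
  | add u₁ u₂ h₁ h₂ =>
    simp only [add_lie, lie_add, map_add, LinearMap.add_apply]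
    linear_combination h₁ + h₂
  | tmul f x =>
    induction v with
    | zero => simp
    | add v₁ v₂ h₁ h₂ =>
      simp only [add_lie, lie_add, map_add, LinearMap.add_apply]
      linear_combination h₁ + h₂
    | tmul g y =>
      induction w with
      | zero => simp
      | add w₁ w₂ h₁ h₂ =>
        simp only [add_lie, lie_add, map_add, LinearMap.add_apply]
        linear_combination h₁ + h₂
      | tmul h z =>
        simp only [LieAlgebra.ExtendScalars.bracket_tmul, hc]
        rw [hBsymm ⁅y, z⁆ x, ← hBinv x y z, hBinv z x y, hBsymm z ⁅x, y⁆, ← mul_add, ← mul_add,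
          ← map_add, ← map_add]
        have key : D (f * g) * h + D (g * h) * f + D (h * f) * g
            = D (f * g * h) + D (f * g * h) := by
          simp only [hD]
          ring
        rw [key, map_add, hres, add_zero, mul_zero]

/-- The bilinear map `c(f⊗x, g⊗y) = B(x,y)·res((Df)·g)` is a 2-cocycle
on the loop algebra `A ⊗ₖ 𝔩`: it is skew-symmetric and satisfies the cocycle identity.
Consequently the bracket `⁅(s,u),(t,v)⁆ := (c(u,v), ⁅u,v⁆)` makes `k ⊕ (A ⊗ 𝔩)` into a
Lie algebra over `k`, a central extension of `A ⊗ 𝔩` by `k` (the generalized Kac–Moody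
extension). -/
theorem statement9
    (k A 𝔩 : Type*) [Field k] [CharZero k] [CommRing A] [Algebra k A]
    [LieRing 𝔩] [LieAlgebra k 𝔩]
    (D : A →ₗ[k] A) (hD : ∀ f g : A, D (f * g) = D f * g + f * D g)
    (res : A →ₗ[k] k) (hres : ∀ f : A, res (D f) = 0)
    (B : 𝔩 →ₗ[k] 𝔩 →ₗ[k] k)
    (hBsymm : ∀ x y : 𝔩, B x y = B y x)
    (hBinv : ∀ x y z : 𝔩, B ⁅x, y⁆ z = B x ⁅y, z⁆)
    (hbracket : ∀ (f g : A) (x y : 𝔩),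
      ⁅(f ⊗ₜ[k] x : A ⊗[k] 𝔩), (g ⊗ₜ[k] y : A ⊗[k] 𝔩)⁆ = (f * g) ⊗ₜ[k] ⁅x, y⁆)
    (c : (A ⊗[k] 𝔩) →ₗ[k] (A ⊗[k] 𝔩) →ₗ[k] k)
    (hc : ∀ (f g : A) (x y : 𝔩),
      c (f ⊗ₜ[k] x) (g ⊗ₜ[k] y) = B x y * res (D f * g)) :
    -- (a) skew-symmetry
    (∀ u v : A ⊗[k] 𝔩, c u v = - c v u) ∧
    -- (b) the 2-cocycle identity
    (∀ u v w : A ⊗[k] 𝔩, c ⁅u, v⁆ w + c ⁅v, w⁆ u + c ⁅w, u⁆ v = 0) ∧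
    -- consequently `⁅(s,u),(t,v)⁆ := (c(u,v), ⁅u,v⁆)` is a Lie bracket on `k ⊕ (A ⊗ 𝔩)`:
    -- bilinear …
    (∀ (a : k) (p p' q : k × (A ⊗[k] 𝔩)),
      QPar.extBr k A 𝔩 c (a • p + p') q =
        a • QPar.extBr k A 𝔩 c p q + QPar.extBr k A 𝔩 c p' q) ∧
    (∀ (a : k) (p q q' : k × (A ⊗[k] 𝔩)),
      QPar.extBr k A 𝔩 c p (a • q + q') =
        a • QPar.extBr k A 𝔩 c p q + QPar.extBr k A 𝔩 c p q') ∧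
    -- … alternating …
    (∀ p : k × (A ⊗[k] 𝔩), QPar.extBr k A 𝔩 c p p = 0) ∧
    -- … satisfying the Jacobi identity …
    (∀ p q r : k × (A ⊗[k] 𝔩),
      QPar.extBr k A 𝔩 c (QPar.extBr k A 𝔩 c p q) r +
        QPar.extBr k A 𝔩 c (QPar.extBr k A 𝔩 c q r) p +
        QPar.extBr k A 𝔩 c (QPar.extBr k A 𝔩 c r p) q = 0) ∧
    -- … with `k ⊕ 0` central, and the second projection a Lie algebra homomorphism
    -- onto `A ⊗ 𝔩`: a central extension of `A ⊗ 𝔩` by `k`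
    (∀ (s : k) (q : k × (A ⊗[k] 𝔩)),
      QPar.extBr k A 𝔩 c ((s, 0) : k × (A ⊗[k] 𝔩)) q = 0 ∧
        QPar.extBr k A 𝔩 c q ((s, 0) : k × (A ⊗[k] 𝔩)) = 0) ∧
    (∀ p q : k × (A ⊗[k] 𝔩), (QPar.extBr k A 𝔩 c p q).2 = ⁅p.2, q.2⁆) := by
  have skew := QPar.residue_pairing_skew hD hres hBsymm hc
  have cocycle := QPar.residue_pairing_cocycle hD hres hBsymm hBinv hc
  refine ⟨skew, cocycle, fun a p p' q => ?_, fun a p q q' => ?_, fun p => ?_, fun p q r => ?_,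
    fun s q => ?_, fun p q => rfl⟩
  · ext1 <;> simp [QPar.extBr]
  · ext1 <;> simp [QPar.extBr]
  · ext1
    · exact self_eq_neg.mp (skew p.2 p.2)
    · exact lie_self p.2
  · ext1
    · exact cocycle p.2 q.2 r.2
    · have h := lie_jacobi r.2 p.2 q.2
      rw [← lie_skew r.2 ⁅p.2, q.2⁆, ← lie_skew p.2 ⁅q.2, r.2⁆,
        ← lie_skew q.2 ⁅r.2, p.2⁆, ← neg_add, ← neg_add,
        neg_eq_zero] at h
      exact h
  · simp [QPar.extBr]
end
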